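/- Let (X,𝒰) be a compact uniform space, let f : X → X be a continuous map, and let K ⊆ X be a closed subset. If h_u(f,K) > 0, then K contains an entropy point, i.e. K ∩ Ent(X,f) ≠ ∅. -/

import Mathlib

open Set Filter UniformSpace Uniformity ENNReal

/-- `A` is an `(n,E,f)`-separated subset of `K`: any two distinct points of `A` are
`E`-separated at some time `i < n`. -/
def IsSeparatedIn {X : Type*} (f : X → X) (K : Set X) (E : Set (X × X)) (n : ℕ)
    (A : Set X) : Prop :=
  A ⊆ K ∧ ∀ x ∈ A, ∀ y ∈ A, x ≠ y → ∃ i < n, (f^[i] x, f^[i] y) ∉ E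

/-- `sep(n,E,f,K)`: the maximal cardinality of an `(n,E,f)`-separated subset of `K`. -/
noncomputable def sepMaxcard {X : Type*} (f : X → X) (K : Set X) (E : Set (X × X))
    (n : ℕ) : ℕ∞ :=
  ⨆ (A : Set X) (_ : IsSeparatedIn f K E n A), A.encard

/-- The exponential growth rate of `sep(n,E,f,K)` at a fixed entourage `E`. -/
noncomputable def sepEntropyEntourage {X : Type*} (f : X → X) (K : Set X)
    (E : Set (X × X)) : EReal :=
  Filter.atTop.limsup fun n : ℕ => ENNReal.log (sepMaxcard f K E n) / n

/-- The uniform entropy `h_u(f,K)`: supremum over entourages of the exponential growth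
rate of maximal separated sets. -/
noncomputable def unifEntropy {X : Type*} [UniformSpace X] (f : X → X) (K : Set X) : EReal :=
  ⨆ E ∈ 𝓤 X, sepEntropyEntourage f K E

/-- The set of entropy points of `f`: points all of whose neighborhood closures carry
positive uniform entropy. -/
def entropyPoints {X : Type*} [UniformSpace X] (f : X → X) : Set X :=
  {x | ∀ V : Set X, IsOpen V → x ∈ V → 0 < unifEntropy f (closure V)}

theorem IsSeparatedIn.restrict {X : Type*} {f : X → X} {K L : Set X} {E : Set (X × X)}
    {n : ℕ} {A : Set X} (hA : IsSeparatedIn f K E n A) : IsSeparatedIn f L E n (A ∩ L) :=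
  ⟨inter_subset_right, fun x hx y hy hxy => hA.2 x hx.1 y hy.1 hxy⟩

theorem IsSeparatedIn.encard_le_sepMaxcard {X : Type*} {f : X → X} {K : Set X}
    {E : Set (X × X)} {n : ℕ} {A : Set X} (hA : IsSeparatedIn f K E n A) :
    A.encard ≤ sepMaxcard f K E n :=
  le_iSup₂_of_le A hA le_rfl

theorem sepMaxcard_empty {X : Type*} (f : X → X) (E : Set (X × X)) (n : ℕ) :
    sepMaxcard f ∅ E n = 0 := by
  refine le_antisymm (iSup₂_le fun A hA => ?_) bot_le
  rw [subset_empty_iff.1 hA.1, encard_empty]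

theorem sepMaxcard_mono {X : Type*} (f : X → X) {K L : Set X} (h : K ⊆ L) (E : Set (X × X))
    (n : ℕ) : sepMaxcard f K E n ≤ sepMaxcard f L E n :=
  iSup₂_le fun _ hA => IsSeparatedIn.encard_le_sepMaxcard ⟨hA.1.trans h, hA.2⟩

theorem sepMaxcard_union_le {X : Type*} (f : X → X) (K L : Set X) (E : Set (X × X)) (n : ℕ) :
    sepMaxcard f (K ∪ L) E n ≤ sepMaxcard f K E n + sepMaxcard f L E n := by
  refine iSup₂_le fun A hA => ?_
  calc A.encard = ((A ∩ K) ∪ (A ∩ L)).encard := by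
        rw [← inter_union_distrib_left, inter_eq_left.2 hA.1]
    _ ≤ (A ∩ K).encard + (A ∩ L).encard := encard_union_le _ _
    _ ≤ _ := add_le_add hA.restrict.encard_le_sepMaxcard hA.restrict.encard_le_sepMaxcard

theorem sepEntropyEntourage_eq_expGrowthSup {X : Type*} (f : X → X) (K : Set X)
    (E : Set (X × X)) :
    sepEntropyEntourage f K E = ExpGrowth.expGrowthSup fun n => (sepMaxcard f K E n : ℝ≥0∞) :=
  rfl

theorem sepEntropyEntourage_empty {X : Type*} (f : X → X) (E : Set (X × X)) :
    sepEntropyEntourage f ∅ E = ⊥ := by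
  simp only [sepEntropyEntourage_eq_expGrowthSup, sepMaxcard_empty, ENat.toENNReal_zero]
  exact ExpGrowth.expGrowthSup_zero

theorem sepEntropyEntourage_mono {X : Type*} (f : X → X) {K L : Set X} (h : K ⊆ L)
    (E : Set (X × X)) : sepEntropyEntourage f K E ≤ sepEntropyEntourage f L E :=
  ExpGrowth.expGrowthSup_monotone fun n => ENat.toENNReal_le.2 (sepMaxcard_mono f h E n)

theorem sepEntropyEntourage_union_le {X : Type*} (f : X → X) (K L : Set X)
    (E : Set (X × X)) :
    sepEntropyEntourage f (K ∪ L) E ≤ sepEntropyEntourage f K E ⊔ sepEntropyEntourage f L E := by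
  simp only [sepEntropyEntourage_eq_expGrowthSup]
  rw [← ExpGrowth.expGrowthSup_add]
  refine ExpGrowth.expGrowthSup_monotone fun n => ?_
  rw [Pi.add_apply, ← ENat.toENNReal_add]
  exact ENat.toENNReal_le.2 (sepMaxcard_union_le f K L E n)

theorem unifEntropy_empty {X : Type*} [UniformSpace X] (f : X → X) : unifEntropy f ∅ = ⊥ := by
  simp [unifEntropy, sepEntropyEntourage_empty]

theorem unifEntropy_mono {X : Type*} [UniformSpace X] (f : X → X) {K L : Set X} (h : K ⊆ L) :
    unifEntropy f K ≤ unifEntropy f L :=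
  iSup₂_mono fun E _ => sepEntropyEntourage_mono f h E

theorem unifEntropy_union_le {X : Type*} [UniformSpace X] (f : X → X) (K L : Set X) :
    unifEntropy f (K ∪ L) ≤ unifEntropy f K ⊔ unifEntropy f L :=
  iSup₂_le fun E hE => (sepEntropyEntourage_union_le f K L E).trans <| sup_le_sup
    (le_iSup₂_of_le E hE le_rfl) (le_iSup₂_of_le E hE le_rfl)

/-- Let `X` be a compact uniform space, `f : X → X` a continuous map and `K ⊆ X` a closed
subset. If `h_u(f,K) > 0`, then `K` contains an entropy point. -/
theorem exists_entropyPoint_of_pos_entropy {X : Type*} [UniformSpace X] [CompactSpace X]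
    (f : X → X) (hf : Continuous f) (K : Set X) (hK : IsClosed K)
    (hpos : 0 < unifEntropy f K) : (K ∩ entropyPoints f).Nonempty := by
  by_contra hne
  refine hpos.not_ge (hK.isCompact.induction_on (p := fun S => unifEntropy f S ≤ 0) ?_ ?_ ?_ ?_)
  · simp [unifEntropy_empty]
  · exact fun S T hST hT => (unifEntropy_mono f hST).trans hT
  · exact fun S T hS hT => (unifEntropy_union_le f S T).trans (sup_le hS hT)
  · intro x hx
    have hx' : x ∉ entropyPoints f := fun h => hne ⟨x, hx, h⟩
    simp only [entropyPoints, mem_ofPred_eq, not_forall, not_lt] at hx'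
    obtain ⟨V, hV, hxV, hle⟩ := hx'
    exact ⟨closure V, mem_nhdsWithin_of_mem_nhds
      (mem_of_superset (hV.mem_nhds hxV) subset_closure), hle⟩
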